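/- There do not exist seven pairwise distinct primes p₁, …, p₇, all greater than 3, such that for each i = 1, …, 6 there exists k_i ∈ ZMod p_i with k_i ≠ 0 for which the elliptic curve y² = x³ + k_i over F_{p_i} has exactly p_{i+1} points (including the point at infinity). -/

import Mathlib

/-- The number of `F_p`-rational points, including the point at infinity, of the elliptic curve
`y² = x³ + k` over `F_p`. -/
noncomputable def Npts (p : ℕ) (k : ZMod p) : ℕ :=
  Nat.card (WeierstrassCurve.Affine.Point
    (WeierstrassCurve.toAffine ⟨0, 0, 0, 0, k⟩))

/-- The point count of `y² = x³ + k` as a character sum. -/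
theorem Npts_eq_add_sum_quadraticChar (p : ℕ) [Fact p.Prime] (hp : 3 < p) (k : ZMod p) (hk : k ≠ 0) :
    (Npts p k : ℤ) = p + 1 + ∑ x : ZMod p, quadraticChar (ZMod p) (x ^ 3 + k) := by
  classical
  let W : WeierstrassCurve.Affine (ZMod p) := WeierstrassCurve.toAffine ⟨0, 0, 0, 0, k⟩
  have h2 : (2 : ZMod p) ≠ 0 := by
    intro h
    have := (ZMod.natCast_eq_zero_iff 2 p).1 (by exact_mod_cast h)
    have := Nat.le_of_dvd (by norm_num) this
    omega
  have h3 : (3 : ZMod p) ≠ 0 := by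
    intro h
    have := (ZMod.natCast_eq_zero_iff 3 p).1 (by exact_mod_cast h)
    have := Nat.le_of_dvd (by norm_num) this
    omega
  have hΔ : W.Δ ≠ 0 := by
    have : W.Δ = -(2 ^ 4 * 3 ^ 3 * k ^ 2) := by
      simp only [W, WeierstrassCurve.Δ, WeierstrassCurve.b₂,
        WeierstrassCurve.b₄, WeierstrassCurve.b₆, WeierstrassCurve.b₈]
      ring
    rw [this, neg_ne_zero]
    positivity
  have hns (x y : ZMod p) : W.Nonsingular x y ↔ y ^ 2 = x ^ 3 + k := by
    rw [← W.equation_iff_nonsingular_of_Δ_ne_zero hΔ, W.equation_iff]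
    simp [W]
  let e : W.Point ≃ Option (Σ x : ZMod p, {y : ZMod p // y ^ 2 = x ^ 3 + k}) :=
    { toFun := fun
        | .zero => none
        | .some x y h => some ⟨x, y, (hns x y).1 h⟩
      invFun := fun
        | none => .zero
        | some ⟨x, y, h⟩ => .some x y ((hns x y).2 h)
      left_inv := by rintro (_ | _) <;> rfl
      right_inv := by rintro (_ | _) <;> rfl }
  have hcard : Npts p k = (∑ x : ZMod p, Fintype.card {y : ZMod p // y ^ 2 = x ^ 3 + k}) + 1 := by
    rw [Npts, Nat.card_congr e, Nat.card_eq_fintype_card, Fintype.card_option, Fintype.card_sigma]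
  have hsq (a : ZMod p) : (Fintype.card {y : ZMod p // y ^ 2 = a} : ℤ)
      = quadraticChar (ZMod p) a + 1 := by
    rw [← quadraticChar_card_sqrts (by rw [ZMod.ringChar_zmod_n]; omega) a, Set.toFinset_card]
    rfl
  rw [hcard]
  push_cast
  simp_rw [hsq, Finset.sum_add_distrib]
  simp
  ring

open Finset in
/-- The number of cube roots of `u` in terms of a cubic character. -/
theorem card_cube_roots {F : Type*} [Field F] [Fintype F] [DecidableEq F]
    (hF : 3 ∣ Fintype.card F - 1) {ψ : MulChar F ℂ} (hψ : orderOf ψ = 3) (u : F) :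
    (#{x : F | x ^ 3 = u} : ℂ) = 1 + ψ u + (ψ⁻¹) u := by
  have hψ3 : ψ ^ 3 = 1 := hψ ▸ pow_orderOf_eq_one ψ
  obtain ⟨g, hg⟩ := IsCyclic.exists_generator (α := Fˣ)
  have hg1 : orderOf g = Fintype.card F - 1 := by
    rw [orderOf_eq_card_of_forall_mem_zpowers hg, Nat.card_units, Nat.card_eq_fintype_card]
  have hF0 : Fintype.card F - 1 ≠ 0 := by have := Fintype.one_lt_card (α := F); omega
  obtain ⟨m, hm⟩ := hF
  have hζ : IsPrimitiveRoot ((g ^ m : Fˣ) : F) 3 := by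
    rw [IsPrimitiveRoot.coe_units_iff, IsPrimitiveRoot.iff_orderOf,
      orderOf_pow_of_dvd (by rintro rfl; simp_all) (by rw [hg1, hm]; exact dvd_mul_left _ _), hg1, hm]
    exact Nat.mul_div_cancel _ (Nat.pos_of_ne_zero (by rintro rfl; simp_all))
  have hcount : #{x : F | x ^ 3 = u} = if ∃ α, α ^ 3 = u then (if u = 0 then 1 else 3) else 0 := by
    split_ifs with h1 h2
    · subst h2; simp [Finset.filter_eq']
    · have h := hζ.card_nthRoots u
      rw [if_pos h1] at h
      refine Eq.trans ?_ ((Multiset.toFinset_card_of_nodup (hζ.nthRoots_nodup h2)).trans h)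
      congr 1
      ext x
      simp
    · simpa [Finset.filter_eq_empty_iff] using h1
  rw [hcount]
  by_cases hu : u = 0
  · subst hu
    rw [if_pos ⟨0, by simp⟩, if_pos rfl, MulChar.map_zero, MulChar.map_zero]
    simp
  have ha3 : ψ g ^ 3 = 1 := by
    rw [← MulChar.pow_apply_coe, hψ3, MulChar.one_apply_coe]
  have ha1 : ψ g ≠ 1 := by
    intro h
    have : ψ = 1 := by
      ext v
      obtain ⟨i, rfl⟩ := mem_powers_iff_mem_zpowers.2 (hg v)
      simp [h]
    simp [this] at hψ
  have ha : 1 + ψ g + ψ g ^ 2 = 0 := by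
    have : (ψ g - 1) * (1 + ψ g + ψ g ^ 2) = 0 := by linear_combination ha3
    exact (mul_eq_zero.1 this).resolve_left (sub_ne_zero.2 ha1)
  have hinv : (ψ⁻¹) u = ψ u ^ 2 := by
    have : ψ⁻¹ = ψ ^ 2 := inv_eq_of_mul_eq_one_right (by rw [← hψ3, pow_succ' ψ 2])
    rw [this, MulChar.pow_apply' _ (by norm_num)]
  rw [hinv]
  obtain ⟨i, hi⟩ := mem_powers_iff_mem_zpowers.2 (hg (Units.mk0 u hu))
  have hi' : u = (g : F) ^ i := by
    simpa using congrArg Units.val hi.symm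
  have hui : ψ u = ψ g ^ (i % 3) := by
    rw [hi', map_pow]
    conv_lhs => rw [← Nat.div_add_mod i 3, pow_add, pow_mul, ha3, one_pow, one_mul]
  rw [hui]
  have hcube : (∃ α, α ^ 3 = u) → ψ u = 1 := by
    rintro ⟨α, rfl⟩
    have hα : α ≠ 0 := by rintro rfl; simp at hu
    rw [map_pow, ← MulChar.pow_apply' _ (by norm_num), hψ3, MulChar.one_apply (by simpa using hα)]
  have hlt : i % 3 < 3 := Nat.mod_lt _ (by norm_num)
  rw [hui] at hcube
  interval_cases hr : i % 3
  · have : ∃ α, α ^ 3 = u := ⟨(g : F) ^ (i / 3), by rw [← pow_mul, hi']; congr 1; omega⟩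
    rw [if_pos this, if_neg hu]
    norm_num
  · rw [if_neg fun h => ha1 (by simpa using hcube h)]
    push_cast
    linear_combination -ha
  · rw [if_neg fun h => ha1 (by linear_combination ha3 - ψ g * hcube h)]
    push_cast
    linear_combination -ha - ψ g * ha3

theorem mem_adjoin_primitiveRoot_six {μ z : ℂ} (hμ : μ ^ 2 = μ - 1) (hz : z ∈ Algebra.adjoin ℤ {μ}) :
    ∃ x y : ℤ, z = x + y * μ := by
  induction hz using Algebra.adjoin_induction with
  | mem z hz => exact ⟨0, 1, by simpa using hz⟩
  | algebraMap r => exact ⟨r, 0, by simp⟩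
  | add z w _ _ hz hw =>
    obtain ⟨a, b, rfl⟩ := hz
    obtain ⟨c, d, rfl⟩ := hw
    exact ⟨a + c, b + d, by push_cast; ring⟩
  | mul z w _ _ hz hw =>
    obtain ⟨a, b, rfl⟩ := hz
    obtain ⟨c, d, rfl⟩ := hw
    exact ⟨a * c - b * d, a * d + b * c + b * d, by push_cast; linear_combination (b * d : ℂ) * hμ⟩

/-- For `p ≡ 1 mod 3`, the trace `t` of Frobenius of `y² = x³ + k` satisfies `4p = t² + 3s²`. -/
theorem exists_trace_of_one_mod_three (p : ℕ) [Fact p.Prime] (hp : 3 < p) (hp3 : 3 ∣ p - 1)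
    (k : ZMod p) (hk : k ≠ 0) :
    ∃ t s : ℤ, ∑ x : ZMod p, quadraticChar (ZMod p) (x ^ 3 + k) = -t ∧
      4 * (p : ℤ) = t ^ 2 + 3 * s ^ 2 := by
  have hchar : ringChar (ZMod p) ≠ 2 := by rw [ZMod.ringChar_zmod_n]; omega
  have hcard : 3 ∣ Fintype.card (ZMod p) - 1 := by rwa [ZMod.card]
  obtain ⟨ψ, hψ⟩ := MulChar.exists_mulChar_orderOf (ZMod p) hcard
    (Complex.isPrimitiveRoot_exp 3 (by norm_num))
  have hψ3 : ψ ^ 3 = 1 := hψ ▸ pow_orderOf_eq_one ψ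
  have hψ1 : ψ ≠ 1 := by rintro rfl; simp at hψ
  let χ : MulChar (ZMod p) ℂ := (quadraticChar (ZMod p)).ringHomComp (Int.castRingHom ℂ)
  have hχq : χ.IsQuadratic := (quadraticChar_isQuadratic (ZMod p)).comp _
  have hχ2 : χ ^ 2 = 1 := hχq.sq_eq_one
  have hχ1 : χ ≠ 1 :=
    (MulChar.ringHomComp_ne_one_iff (RingHom.injective_int _)).2 (quadraticChar_ne_one hchar)
  have hψχ : ψ * χ ≠ 1 := by
    intro h
    have h3 : (ψ * χ) ^ 3 = χ := by rw [mul_pow, hψ3, one_mul, pow_succ, hχ2, one_mul]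
    exact hχ1 (by rw [← h3, h, one_pow])
  obtain ⟨μ, hμ⟩ : ∃ μ : ℂ, IsPrimitiveRoot μ 6 := ⟨_, Complex.isPrimitiveRoot_exp 6 (by norm_num)⟩
  have hμ3 : μ ^ 3 = -1 := by
    have h6 := hμ.pow_eq_one
    have h3 := hμ.pow_ne_one_of_pos_of_lt (l := 3) (by norm_num) (by norm_num)
    have : (μ ^ 3 - 1) * (μ ^ 3 + 1) = 0 := by linear_combination h6
    linear_combination (mul_eq_zero.1 this).resolve_left (sub_ne_zero.2 h3)
  have hμ2 : μ ^ 2 = μ - 1 := by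
    have h2 := hμ.pow_ne_one_of_pos_of_lt (l := 2) (by norm_num) (by norm_num)
    have h1 : μ + 1 ≠ 0 := fun h => h2 (by linear_combination (μ - 1) * h)
    have : (μ + 1) * (μ ^ 2 - μ + 1) = 0 := by linear_combination hμ3
    linear_combination (mul_eq_zero.1 this).resolve_left h1
  have hμbar : star μ = 1 - μ := by
    have h : star μ = μ⁻¹ := by
      rw [Complex.inv_eq_conj (hμ.norm'_eq_one (by norm_num))]; rfl
    rw [h]
    exact inv_eq_of_mul_eq_one_right (by linear_combination -hμ2)
  let A : ℂ := ∑ u : ZMod p, χ (u + k) * ψ u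
  have hA : A = χ k * ψ (-k) * jacobiSum ψ χ := by
    rw [jacobiSum, Finset.mul_sum]
    refine (Fintype.sum_equiv (Equiv.mulLeft₀ (-k) (neg_ne_zero.2 hk)) _ _ fun v => ?_).symm
    rw [Equiv.mulLeft₀_apply, show -k * v + k = k * (1 - v) by ring, map_mul, map_mul]
    ring
  have hstarχ (a : ZMod p) : star (χ a) = χ a := by rw [MulChar.star_apply', hχq.inv]
  have hAstar : star A = ∑ u : ZMod p, χ (u + k) * (ψ⁻¹) u := by
    simp only [A, star_sum, star_mul', hstarχ, MulChar.star_apply']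
  have hsum : ((∑ x : ZMod p, quadraticChar (ZMod p) (x ^ 3 + k) : ℤ) : ℂ) = A + star A := by
    have h0 : ∑ u : ZMod p, χ (u + k) = 0 := by
      exact (Fintype.sum_equiv (Equiv.addRight k) _ (fun u => χ u) fun _ => rfl).trans
        (MulChar.sum_eq_zero_of_ne_one hχ1)
    calc ((∑ x : ZMod p, quadraticChar (ZMod p) (x ^ 3 + k) : ℤ) : ℂ)
        = ∑ x : ZMod p, χ (x ^ 3 + k) := by push_cast; rfl
      _ = ∑ u : ZMod p, ∑ x : ZMod p with x ^ 3 = u, χ (x ^ 3 + k) :=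
          (Finset.sum_fiberwise _ _ _).symm
      _ = ∑ u : ZMod p, χ (u + k) * (1 + ψ u + (ψ⁻¹) u) := by
          refine Finset.sum_congr rfl fun u _ => ?_
          rw [← card_cube_roots hcard hψ u, mul_comm, ← nsmul_eq_mul, ← Finset.sum_const]
          refine Finset.sum_congr rfl fun x hx => ?_
          rw [(Finset.mem_filter.1 hx).2]
      _ = A + star A := by
          rw [hAstar]
          simp only [mul_add, mul_one, Finset.sum_add_distrib, h0, zero_add, A]
  have hnorm : A * star A = p := by
    have hJ : star (jacobiSum ψ χ) = jacobiSum ψ⁻¹ χ⁻¹ := by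
      simp only [jacobiSum, star_sum, star_mul', MulChar.star_apply']
    have hJJ := jacobiSum_mul_jacobiSum_inv (F := ZMod p) (F' := ℂ)
      (by rw [ZMod.ringChar_zmod_n, ringChar.eq_zero]; omega) hψ1 hχ1 hψχ
    have h1 : χ k * star (χ k) = 1 := by
      rw [hstarχ, ← pow_two, ← MulChar.pow_apply' _ (by norm_num), hχ2,
        MulChar.one_apply (by simpa using hk)]
    have h2 : ψ (-k) * star (ψ (-k)) = 1 := by
      rw [MulChar.star_apply', ← MulChar.mul_apply, mul_inv_cancel,
        MulChar.one_apply (by simpa using hk)]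
    rw [ZMod.card] at hJJ
    rw [hA, star_mul', star_mul', hJ]
    linear_combination (ψ (-k) * star (ψ (-k)) * jacobiSum ψ χ * jacobiSum ψ⁻¹ χ⁻¹) * h1
      + (jacobiSum ψ χ * jacobiSum ψ⁻¹ χ⁻¹) * h2 + hJJ
  have hmem : A ∈ Algebra.adjoin ℤ {μ} := by
    have hψ6 : ψ ^ 6 = 1 := by rw [show 6 = 3 * 2 by norm_num, pow_mul, hψ3, one_pow]
    have hχ6 : χ ^ 6 = 1 := by rw [show 6 = 2 * 3 by norm_num, pow_mul, hχ2, one_pow]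
    exact Subalgebra.sum_mem _ fun _ _ => Subalgebra.mul_mem _
      (MulChar.apply_mem_algebraAdjoin_of_pow_eq_one hχ6 hμ _)
      (MulChar.apply_mem_algebraAdjoin_of_pow_eq_one hψ6 hμ _)
  obtain ⟨x, y, hxy⟩ := mem_adjoin_primitiveRoot_six hμ2 hmem
  have hxys : star A = x + y * (1 - μ) := by
    rw [hxy, star_add, star_mul', hμbar]
    simp
  refine ⟨-(2 * x + y), y, ?_, ?_⟩
  · rw [hxys, hxy] at hsum
    have : ((∑ x : ZMod p, quadraticChar (ZMod p) (x ^ 3 + k) : ℤ) : ℂ) = ((2 * x + y : ℤ) : ℂ) := by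
      rw [hsum]; push_cast; ring
    rw [neg_neg]
    exact_mod_cast this
  · rw [hxys, hxy] at hnorm
    have : ((4 * (p : ℤ) : ℤ) : ℂ) = (((-(2 * x + y)) ^ 2 + 3 * y ^ 2 : ℤ) : ℂ) := by
      push_cast
      linear_combination -4 * hnorm - 4 * (y : ℂ) ^ 2 * hμ2
    exact_mod_cast this

theorem Npts_eq_of_two_mod_three (p : ℕ) [Fact p.Prime] (hp : 3 < p) (hp3 : p % 3 = 2)
    (k : ZMod p) (hk : k ≠ 0) : Npts p k = p + 1 := by
  have hinj : Function.Injective fun x : ZMod p => x ^ 3 := by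
    have hroot (x : ZMod p) : (x ^ 3) ^ (2 * (p / 3) + 1) = x := by
      have hx := ZMod.pow_card x
      calc (x ^ 3) ^ (2 * (p / 3) + 1) = x ^ p * x ^ (p - 1) := by
            rw [← pow_mul, ← pow_add]; congr 1; omega
        _ = x ^ p := by rw [hx, ← pow_succ', Nat.sub_add_cancel (by omega), hx]
        _ = x := hx
    intro x y h
    rw [← hroot x, ← hroot y]
    exact congrArg (· ^ (2 * (p / 3) + 1)) h
  have hsum : ∑ x : ZMod p, quadraticChar (ZMod p) (x ^ 3 + k) = 0 := by
    have hbij : Function.Bijective fun x : ZMod p => x ^ 3 + k :=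
      Finite.injective_iff_bijective.1 ((add_left_injective k).comp hinj)
    rw [hbij.sum_comp (fun u => quadraticChar (ZMod p) u)]
    exact quadraticChar_sum_zero (by rw [ZMod.ringChar_zmod_n]; omega)
  have := Npts_eq_add_sum_quadraticChar p hp k hk
  rw [hsum] at this
  omega

/-- The norm of `1 + 2√-3 (m + n ω)` for `w = (m, n)`. -/
def primaryNorm (w : ℤ × ℤ) : ℤ := 12 * (w.1 ^ 2 - w.1 * w.2 + w.2 ^ 2) - 6 * w.2 + 1

/-- Multiplication by the sixth root of unity `1 + ω` in the basis `(1, ω)`. -/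
def rotate (w : ℤ × ℤ) : ℤ × ℤ := (w.1 - w.2, w.1)

theorem exists_primaryNorm_of_pair {p q : ℕ} (hp : p.Prime) (hq : q.Prime) (hp3 : 3 < p)
    (hq3 : 3 < q) {k : ZMod p} (hk : k ≠ 0) (h : Npts p k = q) :
    ∃ w : ℤ × ℤ, (p : ℤ) = primaryNorm w ∧ (q : ℤ) = primaryNorm (rotate w) := by
  have : Fact p.Prime := ⟨hp⟩
  have hp2 : p % 2 = 1 := hp.eq_two_or_odd.resolve_left (by omega)
  have hq2 : q % 2 = 1 := hq.eq_two_or_odd.resolve_left (by omega)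
  have hpm : p % 3 ≠ 0 := fun h0 => by
    have := (Nat.prime_dvd_prime_iff_eq Nat.prime_three hp).1 (Nat.dvd_of_mod_eq_zero h0); omega
  have hqm : q % 3 ≠ 0 := fun h0 => by
    have := (Nat.prime_dvd_prime_iff_eq Nat.prime_three hq).1 (Nat.dvd_of_mod_eq_zero h0); omega
  have hp1 : p % 3 = 1 := by
    by_contra hne
    have := Npts_eq_of_two_mod_three p hp3 (by omega) k hk
    omega
  obtain ⟨t, s, hS, hts⟩ := exists_trace_of_one_mod_three p hp3 (by omega) k hk
  have hN := Npts_eq_add_sum_quadraticChar p hp3 k hk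
  rw [hS, h] at hN
  have ht3 : t % 3 = 1 := by
    have h0 : t % 3 ≠ 0 := fun h0 => by
      obtain ⟨c, rfl⟩ := Int.dvd_of_emod_eq_zero h0
      have : 4 * (p : ℤ) = 3 * (3 * c ^ 2 + s ^ 2) := by rw [hts]; ring
      omega
    omega
  obtain ⟨r, rfl⟩ : ∃ r, t = 6 * r + 1 := ⟨t / 6, by omega⟩
  have hs2 : s % 2 = 1 := by
    by_contra hne
    obtain ⟨c, rfl⟩ : ∃ c, s = 2 * c := ⟨s / 2, by omega⟩
    have : 4 * (p : ℤ) = 2 * (18 * r ^ 2 + 6 * r + 6 * c ^ 2) + 1 := by rw [hts]; ring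
    omega
  obtain ⟨n, hn⟩ : ∃ n, s = 4 * n + 2 * r - 1 ∨ s = -(4 * n + 2 * r - 1) := by
    by_cases h4 : (s - 2 * r + 1) % 4 = 0
    · exact ⟨(s - 2 * r + 1) / 4, by omega⟩
    · exact ⟨(-s - 2 * r + 1) / 4, by omega⟩
  have hs : s ^ 2 = (4 * n + 2 * r - 1) ^ 2 := sq_eq_sq_iff_eq_or_eq_neg.2 hn
  have hpn : (p : ℤ) = primaryNorm (n + r, n) := by
    have : 4 * (p : ℤ) = 4 * primaryNorm (n + r, n) := by
      rw [hts, hs, primaryNorm]; ring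
    omega
  refine ⟨(n + r, n), hpn, ?_⟩
  rw [hN, hpn]
  simp only [primaryNorm, rotate]
  ring

theorem eq_sq_add_three_mul_sq_unique {p : ℕ} (hp : p.Prime) {a b c d : ℤ}
    (hab : (p : ℤ) = a ^ 2 + 3 * b ^ 2) (hcd : (p : ℤ) = c ^ 2 + 3 * d ^ 2) :
    a ^ 2 = c ^ 2 ∧ b ^ 2 = d ^ 2 := by
  have hp0 : (p : ℤ) ≠ 0 := by exact_mod_cast hp.ne_zero
  have hprod : (a * d - b * c) * (a * d + b * c) = p * (d ^ 2 - b ^ 2) := by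
    linear_combination (-d ^ 2) * hab + b ^ 2 * hcd
  have key : ∀ e x y : ℤ, (p : ℤ) ^ 2 = x ^ 2 + 3 * y ^ 2 → y = p * e → y = 0 := by
    rintro e x y h rfl
    have he : e = 0 := by
      by_contra he
      have : 1 ≤ e ^ 2 := by have := pow_pos (abs_pos.2 he) 2; rw [sq_abs] at this; omega
      have : 0 < (p : ℤ) ^ 2 := by positivity
      nlinarith [sq_nonneg x]
    rw [he, mul_zero]
  have h0 : (a * d - b * c) * (a * d + b * c) = 0 := by
    have hdvd : (p : ℤ) ∣ (a * d - b * c) * (a * d + b * c) := ⟨_, hprod⟩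
    rcases (Nat.prime_iff_prime_int.1 hp).dvd_or_dvd hdvd with ⟨e, he⟩ | ⟨e, he⟩
    · rw [key e (a * c + 3 * b * d) _ ?_ he, zero_mul]
      linear_combination (p : ℤ) * hab + (a ^ 2 + 3 * b ^ 2) * hcd
    · rw [key e (a * c - 3 * b * d) _ ?_ he, mul_zero]
      linear_combination (p : ℤ) * hab + (a ^ 2 + 3 * b ^ 2) * hcd
  have hbd : d ^ 2 - b ^ 2 = 0 := by
    rw [h0] at hprod
    exact (mul_eq_zero.1 hprod.symm).resolve_left hp0
  constructor <;> linarith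

theorem primaryNorm_unique {p : ℕ} (hp : p.Prime) {v w : ℤ × ℤ} (hv : (p : ℤ) = primaryNorm v)
    (hw : (p : ℤ) = primaryNorm w) : w = v ∨ w = (v.2 - v.1, v.2) := by
  obtain ⟨a, b⟩ := v
  obtain ⟨c, d⟩ := w
  simp only [primaryNorm] at hv hw
  obtain ⟨h1, h2⟩ := eq_sq_add_three_mul_sq_unique hp (a := 1 - 3 * b) (b := 2 * a - b)
    (c := 1 - 3 * d) (d := 2 * c - d) (by rw [hv]; ring) (by rw [hw]; ring)
  rw [sq_eq_sq_iff_eq_or_eq_neg] at h1 h2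
  simp only [Prod.mk.injEq]
  omega

theorem rotate_iterate_six (w : ℤ × ℤ) : rotate^[6] w = w := by
  ext <;> simp [rotate]

theorem exists_rotate_of_pair {p q : ℕ} (hp : p.Prime) (hq : q.Prime) (hp3 : 3 < p)
    (hq3 : 3 < q) {k : ZMod p} (hk : k ≠ 0) (h : Npts p k = q) {v : ℤ × ℤ}
    (hv : (p : ℤ) = primaryNorm v) : ∃ j, (q : ℤ) = primaryNorm (rotate^[j] v) := by
  obtain ⟨w, hw, hqw⟩ := exists_primaryNorm_of_pair hp hq hp3 hq3 hk h
  rcases primaryNorm_unique hp hv hw with rfl | rfl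
  · exact ⟨1, hqw⟩
  · refine ⟨5, ?_⟩
    rw [hqw]
    simp only [primaryNorm, rotate, Function.iterate_succ, Function.iterate_zero,
      Function.comp_apply, id_eq]
    ring

/-- Corollary 3.8: there are no proper elliptic lists of length `7` over `d = 3`. -/
theorem stmt_12 :
    ¬ ∃ p : ℕ → ℕ,
      (∀ i < 7, ∀ j < 7, p i = p j → i = j) ∧
      (∀ i < 7, (p i).Prime) ∧ (∀ i < 7, 3 < p i) ∧
      (∀ i < 6, ∃ k : ZMod (p i), k ≠ 0 ∧ Npts (p i) k = p (i + 1)) := by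
  rintro ⟨p, hinj, hp, hp3, hpair⟩
  obtain ⟨w, hw⟩ : ∃ w, (p 0 : ℤ) = primaryNorm w := by
    obtain ⟨k, hk, h⟩ := hpair 0 (by norm_num)
    obtain ⟨w, hw, -⟩ := exists_primaryNorm_of_pair (hp 0 (by norm_num)) (hp 1 (by norm_num))
      (hp3 0 (by norm_num)) (hp3 1 (by norm_num)) hk h
    exact ⟨w, hw⟩
  have horbit : ∀ i < 7, ∃ j, (p i : ℤ) = primaryNorm (rotate^[j] w) := by
    intro i
    induction i with
    | zero => exact fun _ => ⟨0, hw⟩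
    | succ i ih =>
      intro hi
      obtain ⟨j, hj⟩ := ih (by omega)
      obtain ⟨k, hk, h⟩ := hpair i (by omega)
      obtain ⟨l, hl⟩ := exists_rotate_of_pair (hp i (by omega)) (hp (i + 1) hi)
        (hp3 i (by omega)) (hp3 (i + 1) hi) hk h hj
      exact ⟨l + j, by rw [hl, Function.iterate_add_apply]⟩
  choose! j hj using horbit
  obtain ⟨a, ha, b, hb, hab, hmod⟩ := Finset.exists_ne_map_eq_of_card_lt_of_maps_to
    (s := Finset.range 7) (t := Finset.range 6) (f := fun i => j i % 6) (by simp)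
    (fun i _ => by simpa using Nat.mod_lt _ (by norm_num))
  rw [Finset.mem_range] at ha hb
  have hper (n : ℕ) : rotate^[n] w = rotate^[n % 6] w :=
    (Function.IsPeriodicPt.iterate_mod_apply (n := 6) (rotate_iterate_six w) n).symm
  refine hab (hinj a ha b hb ?_)
  have : (p a : ℤ) = p b := by
    rw [hj a ha, hj b hb, hper (j a), hper (j b)]
    exact congrArg (fun n => primaryNorm (rotate^[n] w)) hmod
  exact_mod_cast this
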